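/- Let q be a prime power and i ≥ 1 a positive integer. Then M_{q^{i−1}}(q^{2i−1}, q^{2i−1} − q^{2i−2}) ≥ q(q^i − 1)²/(q − 1). Moreover, when i = 1, one has equality in the corresponding permutation-array case: M_1(q, q−1) = q(q−1). -/

import Mathlib

/-- A frequency permutation array: a finite set `T` of words `ι → α` such that every word
uses each symbol of `α` exactly `lam` times, and distinct words have Hamming distance
at least `d`. -/
def isFPA {ι α : Type*} [Fintype ι] [DecidableEq ι] [DecidableEq α]
    (lam d : ℕ) (T : Finset (ι → α)) : Prop :=
  (∀ w ∈ T, ∀ s : α, (Finset.univ.filter (fun i => w i = s)).card = lam) ∧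
  (∀ w ∈ T, ∀ v ∈ T, w ≠ v → d ≤ hammingDist w v)

/-- `M n m lam d` is the maximum size of a frequency permutation array of words of
length `n` over `m` symbols, each symbol occurring `lam` times, with minimum
Hamming distance `d`. -/
noncomputable def M (n m lam d : ℕ) : ℕ :=
  sSup {N | ∃ T : Finset (Fin n → Fin m), isFPA lam d T ∧ T.card = N}

open Finset in
/-- All fibres of a surjective additive map have the same size. -/
theorem fpa_fiber_card {E W : Type*} [AddCommGroup E] [AddCommGroup W] [Fintype E] [Fintype W]
    [DecidableEq W] (f : E →+ W) (hf : Function.Surjective f) (w : W) :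
    (univ.filter (fun x => f x = w)).card * Fintype.card W = Fintype.card E := by
  classical
  have h : Fintype.card E = ∑ v : W, (univ.filter (fun x => f x = v)).card := by
    rw [← Finset.card_univ]
    exact Finset.card_eq_sum_card_fiberwise (fun _ _ => Finset.mem_coe.2 (mem_univ _))
  have h2 : ∀ v : W, (univ.filter (fun x => f x = v)).card
      = (univ.filter (fun x => f x = w)).card := by
    intro v
    obtain ⟨a, ha⟩ := hf v
    obtain ⟨b, hb⟩ := hf w
    refine Finset.card_bij' (fun x _ => x - a + b) (fun x _ => x - b + a) ?_ ?_ ?_ ?_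
    · intro x hx
      simp only [mem_filter, mem_univ, true_and] at hx ⊢
      simp [hx, ha, hb]
    · intro x hx
      simp only [mem_filter, mem_univ, true_and] at hx ⊢
      simp [hx, ha, hb]
    · intro x _; simp
    · intro x _; simp
  rw [h, Finset.sum_congr rfl (fun v _ => h2 v)]
  simp [mul_comm]

theorem fpa_bddAbove (n m lam d : ℕ) :
    BddAbove {N | ∃ T : Finset (Fin n → Fin m), isFPA lam d T ∧ T.card = N} := by
  refine ⟨Fintype.card (Fin n → Fin m), ?_⟩
  rintro N ⟨T, _, rfl⟩
  exact Finset.card_le_univ T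

theorem fpa_hamming {ι α : Type*} [Fintype ι] [DecidableEq α] (u v : ι → α) :
    (Finset.univ.filter (fun p => u p = v p)).card + hammingDist u v = Fintype.card ι := by
  have := Finset.card_filter_add_card_filter_not (s := (Finset.univ : Finset ι))
    (fun p => u p = v p)
  simpa [hammingDist] using this

/-- An indexed family of words gives a lower bound for `M`. -/
theorem fpa_le_M {J ι α : Type*} [Fintype J] [Fintype ι] [Fintype α]
    [DecidableEq α] (n m lam k : ℕ) (hn : Fintype.card ι = n) (hm : Fintype.card α = m)
    (hk : k < n) (w : J → ι → α)
    (hfreq : ∀ j s, (Finset.univ.filter (fun p => w j p = s)).card = lam)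
    (hagree : ∀ j j', j ≠ j' → (Finset.univ.filter (fun p => w j p = w j' p)).card ≤ k) :
    Fintype.card J ≤ M n m lam (n - k) := by
  classical
  let e : ι ≃ Fin n := Fintype.equivFinOfCardEq hn
  let g : α ≃ Fin m := Fintype.equivFinOfCardEq hm
  let W : J → Fin n → Fin m := fun j p => g (w j (e.symm p))
  have hdist : ∀ j j', j ≠ j' → n - k ≤ hammingDist (W j) (W j') := by
    intro j j' hj
    have h1 := fpa_hamming (W j) (W j')
    have h2 : (Finset.univ.filter (fun p => W j p = W j' p)).card
        = (Finset.univ.filter (fun p => w j p = w j' p)).card := by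
      refine Finset.card_bij' (fun p _ => e.symm p) (fun p _ => e p) ?_ ?_ ?_ ?_ <;>
        simp [W]
    have h3 := hagree j j' hj
    rw [Fintype.card_fin] at h1
    omega
  have hinj : Function.Injective W := by
    intro j j' h
    by_contra hne
    have := hdist j j' hne
    rw [h, hammingDist_self] at this
    omega
  refine le_csSup (fpa_bddAbove _ _ _ _) ⟨Finset.univ.image W, ⟨?_, ?_⟩, ?_⟩
  · intro u hu s
    obtain ⟨j, -, rfl⟩ := Finset.mem_image.1 hu
    rw [← hfreq j (g.symm s)]
    refine Finset.card_bij' (fun p _ => e.symm p) (fun p _ => e p) ?_ ?_ ?_ ?_ <;>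
        simp [W, Equiv.eq_symm_apply]
  · intro u hu v hv huv
    obtain ⟨j, -, rfl⟩ := Finset.mem_image.1 hu
    obtain ⟨j', -, rfl⟩ := Finset.mem_image.1 hv
    exact hdist j j' (fun h => huv (by rw [h]))
  · rw [Finset.card_image_of_injective _ hinj, Finset.card_univ]

theorem fpa_surj {F V : Type*} [Field F] [AddCommGroup V] [Module F V]
    {a : Module.Dual F V} (ha : a ≠ 0) : Function.Surjective a :=
  LinearMap.surjective ha

/-- Two functionals defining different projective points have a surjective joint map. -/
theorem fpa_surj2 {F V : Type*} [Field F] [AddCommGroup V] [Module F V]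
    (p p' : Projectivization F (Module.Dual F V)) (h : p ≠ p') (s t : F) :
    ∃ x : V, p.rep x = s ∧ p'.rep x = t := by
  have : ∃ z, p.rep z = 0 ∧ p'.rep z ≠ 0 := by
    by_contra! hcon
    have hmem := mem_span_of_iInf_ker_le_ker (ι := Unit) (L := fun _ => p.rep) (K := p'.rep)
      (by
        intro z hz
        simp at hz
        exact hcon z hz)
    simp only [Set.range_const, Submodule.mem_span_singleton] at hmem
    obtain ⟨c, hc⟩ := hmem
    apply h
    rw [← p.mk_rep, ← p'.mk_rep, eq_comm, Projectivization.mk_eq_mk_iff']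
    exact ⟨c, hc⟩
  obtain ⟨z, hz, hz'⟩ := this
  obtain ⟨x, hx⟩ := fpa_surj p.rep_nonzero s
  refine ⟨x + ((t - p'.rep x) / p'.rep z) • z, ?_, ?_⟩
  · simp [hx, hz]
  · simp [hz']

theorem fpa_lower (q i : ℕ) (hq : IsPrimePow q) (hi : 1 ≤ i) :
    q * (q ^ i - 1) ^ 2 / (q - 1) ≤
      M (q ^ (2 * i - 1)) (q ^ i) (q ^ (i - 1)) (q ^ (2 * i - 1) - q ^ (2 * i - 2)) := by
  classical
  have hq1 : 1 < q := hq.one_lt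
  obtain ⟨p, k, hp, hk, hpk⟩ := (isPrimePow_nat_iff q).1 hq
  have : Fact p.Prime := ⟨hp⟩
  let F := GaloisField p k
  have : Fintype F := Fintype.ofFinite _
  have hF : Fintype.card F = q := by
    rw [← Nat.card_eq_fintype_card, ← hpk]; exact GaloisField.card p k hk.ne'
  let V := Fin i → F
  have hV : Fintype.card V = q ^ i := by simp [V, hF]
  let D := Module.Dual F V
  have : Finite D := Module.finite_of_finite F
  have : Fintype D := Fintype.ofFinite D
  have hD : Fintype.card D = q ^ i := by
    rw [Module.card_eq_pow_finrank (K := F), hF]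
    simp [D, V, Subspace.dual_finrank_eq]
  let P := Projectivization F D
  have : Fintype P := Fintype.ofFinite P
  have hP : q ^ i - 1 = Fintype.card P * (q - 1) := by
    have := Projectivization.card F D
    simpa only [Nat.card_eq_fintype_card, hD, hF] using this
  let J := P × {b : D // b ≠ 0} × F
  have hJ : Fintype.card J = q * (q ^ i - 1) ^ 2 / (q - 1) := by
    have hb : Fintype.card {b : D // b ≠ 0} = q ^ i - 1 := by simp [hD]
    rw [Fintype.card_prod, Fintype.card_prod, hb, hF]
    symm
    apply Nat.div_eq_of_eq_mul_left (by omega)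
    rw [sq]
    nth_rw 1 [hP]
    ring
  have hqi : q ^ i = q ^ (i - 1) * q := by
    rw [← pow_succ]; congr 1; omega
  have hfib : ∀ (b : D), b ≠ 0 → ∀ c : F,
      (Finset.univ.filter (fun y : V => b y = c)).card = q ^ (i - 1) := by
    intro b hb c
    have h := fpa_fiber_card (b.toAddMonoidHom) (fpa_surj hb) c
    rw [hF, hV, hqi] at h
    exact Nat.eq_of_mul_eq_mul_right (by omega) h
  have hcard : ∀ (j : J) (x : V),
      Fintype.card {y : V // j.2.1.1 y = j.2.2 - j.1.rep x} = q ^ (i - 1) := by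
    intro j x
    rw [Fintype.card_subtype]
    exact hfib _ j.2.1.2 _
  let e : ∀ (j : J) (x : V), {y : V // j.2.1.1 y = j.2.2 - j.1.rep x} ≃ Fin (q ^ (i - 1)) :=
    fun j x => Fintype.equivFinOfCardEq (hcard j x)
  let w : J → V × Fin (q ^ (i - 1)) → V := fun j z => ((e j z.1).symm z.2).1
  have hw : ∀ (j : J) (z : V × Fin (q ^ (i - 1))), j.2.1.1 (w j z) = j.2.2 - j.1.rep z.1 := fun (j : J) (z : V × Fin (q ^ (i - 1))) =>
    ((e j z.1).symm z.2).2
  rw [← hJ]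
  refine fpa_le_M (ι := V × Fin (q ^ (i - 1))) (α := V) _ _ _ _ ?_ hV ?_ w ?_ ?_
  · rw [Fintype.card_prod, hV, Fintype.card_fin, ← pow_add]; congr 1; omega
  · exact Nat.pow_lt_pow_right hq1 (by omega)
  · intro (j : J) (s : V)
    refine Eq.trans ?_ (hfib j.1.rep j.1.rep_nonzero (j.2.2 - j.2.1.1 s))
    refine Finset.card_bij (fun z _ => z.1) ?_ ?_ ?_
    · intro z hz
      simp only [Finset.mem_filter, Finset.mem_univ, true_and] at hz ⊢
      have := hw j z
      rw [hz] at this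
      rw [this]; ring
    · rintro ⟨x, l⟩ hz ⟨x', l'⟩ hz' h
      simp only [Finset.mem_filter, Finset.mem_univ, true_and] at hz hz' h
      subst h
      have : (e j x).symm l = (e j x).symm l' := Subtype.ext (hz.trans hz'.symm)
      rw [(e j x).symm.injective this]
    · intro x hx
      simp only [Finset.mem_filter, Finset.mem_univ, true_and] at hx
      refine ⟨(x, e j x ⟨s, by rw [hx]; ring⟩), ?_, rfl⟩
      simp [w]
  · intro j j' hj
    have hinj : (Finset.univ.filter (fun z => w j z = w j' z)).card ≤
        (Finset.univ.filter (fun z : V × V => j.1.rep z.1 + j.2.1.1 z.2 = j.2.2 ∧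
          j'.1.rep z.1 + j'.2.1.1 z.2 = j'.2.2)).card := by
      refine Finset.card_le_card_of_injOn (fun z => (z.1, w j z)) ?_ ?_
      · intro z hz
        simp only [Finset.coe_filter, Finset.mem_univ, true_and, Set.mem_ofPred_eq] at hz ⊢
        have h1 := hw j z
        have h2 := hw j' z
        rw [← hz] at h2
        constructor
        · rw [h1]; ring
        · rw [h2]; ring
      · rintro ⟨x, l⟩ _ ⟨x', l'⟩ _ h
        simp only [Prod.mk.injEq] at h
        obtain ⟨rfl, h⟩ := h
        have : (e j x).symm l = (e j x).symm l' := Subtype.ext h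
        rw [(e j x).symm.injective this]
    refine hinj.trans ?_
    obtain ⟨a, ⟨b, hb⟩, c⟩ := j
    obtain ⟨a', ⟨b', hb'⟩, c'⟩ := j'
    simp only
    have key : (∀ s t : F, ∃ z : V × V, a.rep z.1 + b z.2 = s ∧ a'.rep z.1 + b' z.2 = t) →
        (Finset.univ.filter (fun z : V × V => a.rep z.1 + b z.2 = c ∧
          a'.rep z.1 + b' z.2 = c')).card ≤ q ^ (2 * i - 2) := by
      intro hs
      let f : V × V →ₗ[F] F × F := (a.rep.coprod b).prod (a'.rep.coprod b')
      have hf : Function.Surjective f.toAddMonoidHom := by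
        rintro ⟨s, t⟩
        obtain ⟨z, h1, h2⟩ := hs s t
        refine ⟨z, ?_⟩
        simp [f, h1, h2]
      have h := fpa_fiber_card f.toAddMonoidHom hf (c, c')
      rw [Fintype.card_prod, Fintype.card_prod, hF, hV, hqi] at h
      have h' : (Finset.univ.filter (fun z : V × V => f.toAddMonoidHom z = (c, c'))).card
          = q ^ (2 * i - 2) := by
        apply Nat.eq_of_mul_eq_mul_right (show 0 < q * q by positivity)
        rw [h, show 2 * i - 2 = (i - 1) + (i - 1) by omega, pow_add]; ring
      rw [← h']
      apply le_of_eq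
      congr 1
      ext z
      simp [f]
    by_cases haa : a = a'
    · subst haa
      by_cases hbb : b = b'
      · subst hbb
        have : c ≠ c' := by
          rintro rfl
          exact hj rfl
        rw [Finset.filter_false_of_mem]
        · simp
        · rintro z _ ⟨h1, h2⟩
          exact this (h1.symm.trans h2)
      · apply key
        intro s t
        obtain ⟨y, hy⟩ := fpa_surj (sub_ne_zero.2 hbb) (s - t)
        obtain ⟨x, hx⟩ := fpa_surj a.rep_nonzero (s - b y)
        refine ⟨(x, y), ?_, ?_⟩
        · simp only [hx]; ring
        · simp only [hx]
          rw [LinearMap.sub_apply] at hy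
          linear_combination -hy
    · apply key
      intro s t
      obtain ⟨x, h1, h2⟩ := fpa_surj2 a a' haa s t
      exact ⟨(x, 0), by simp [h1], by simp [h2]⟩

theorem fpa_upper (q : ℕ) (hq : 1 < q) : M q q 1 (q - 1) ≤ q * (q - 1) := by
  classical
  refine csSup_le' ?_
  rintro N ⟨T, ⟨hfreq, hdist⟩, rfl⟩
  let z0 : Fin q := ⟨0, by omega⟩
  let z1 : Fin q := ⟨1, hq⟩
  have hz : z0 ≠ z1 := by simp [z0, z1]
  have hcard : (Finset.univ : Finset (Fin q)).offDiag.card = q * (q - 1) := by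
    rw [Finset.offDiag_card, Finset.card_univ, Fintype.card_fin, Nat.mul_sub, mul_one]
  rw [← hcard]
  refine Finset.card_le_card_of_injOn (fun w => (w z0, w z1)) ?_ ?_
  · intro w hw
    simp only [Finset.coe_offDiag, Set.mem_offDiag, Finset.coe_univ, Set.mem_univ, true_and]
    intro h
    obtain ⟨x, hx⟩ := Finset.card_eq_one.1 (hfreq w hw (w z0))
    have h0 : z0 ∈ Finset.univ.filter (fun p => w p = w z0) := by simp
    have h1 : z1 ∈ Finset.univ.filter (fun p => w p = w z0) := by simp [h]
    rw [hx, Finset.mem_singleton] at h0 h1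
    exact hz (h0.trans h1.symm)
  · intro w hw v hv h
    by_contra hne
    simp only [Prod.mk.injEq] at h
    have h1 := hdist w hw v hv hne
    have h2 := fpa_hamming w v
    have h3 : 1 < (Finset.univ.filter (fun p => w p = v p)).card := by
      rw [Finset.one_lt_card]
      exact ⟨z0, by simp [h.1], z1, by simp [h.2], hz⟩
    rw [Fintype.card_fin] at h2
    omega

/-- For a prime power `q` and `i ≥ 1`:
`M_{q^{i−1}}(q^{2i−1}, q^{2i−1} − q^{2i−2}) ≥ q(q^i − 1)²/(q−1)`;
moreover, in the `i = 1` permutation-array case, `M_1(q, q−1) = q(q−1)`. -/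
theorem stmt_9 (q i : ℕ) (hq : IsPrimePow q) (hi : 1 ≤ i) :
    q * (q ^ i - 1) ^ 2 / (q - 1) ≤
      M (q ^ (2 * i - 1)) (q ^ i) (q ^ (i - 1)) (q ^ (2 * i - 1) - q ^ (2 * i - 2)) ∧
    M q q 1 (q - 1) = q * (q - 1) := by
  refine ⟨fpa_lower q i hq hi, le_antisymm (fpa_upper q hq.one_lt) ?_⟩
  have h := fpa_lower q 1 hq le_rfl
  have hq1 := hq.one_lt
  have e : q * (q ^ 1 - 1) ^ 2 / (q - 1) = q * (q - 1) := by
    apply Nat.div_eq_of_eq_mul_left (by omega)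
    rw [pow_one, sq, mul_assoc]
  rw [e] at h
  simpa using h
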